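/- arXiv:1805.11320 — 4 statements merged into one kernel-verified Lean document; each statement's English description precedes it below -/
import Mathlib

section
/- Let (M_j)_{j≥0} be a regular weight sequence with m_j = M_j/j!, and define h_1(t) = inf_{k≥1} m_k·t^{k−1} for t > 0. Then for all t > 0 one has h_M(t) ≤ t·h_1(t), and there exists a constant Q > 0 such that h_1(t) ≤ h_M(Q·t) for all t > 0. -/
open scoped Topology
open Filter

/-- `m_j = M_j / j!`. -/
noncomputable def mseq (M : ℕ → ℝ) (j : ℕ) : ℝ := M j / (Nat.factorial j : ℝ)

/-- A weight sequence: positive, normalized `M 0 = 1`, log-convex. -/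
structure IsWeightSeq (M : ℕ → ℝ) : Prop where
  pos : ∀ j, 0 < M j
  one : M 0 = 1
  logConvex : ∀ j : ℕ, 1 ≤ j → (M j) ^ 2 ≤ M (j - 1) * M (j + 1)

/-- Condition (M2): `sup_k (m_{k+1}/m_k)^(1/k) < ∞`. -/
def CondM2 (M : ℕ → ℝ) : Prop :=
  ∃ C : ℝ, ∀ k : ℕ, 1 ≤ k → (mseq M (k + 1) / mseq M k) ^ ((1 : ℝ) / k) ≤ C

/-- Condition (M3): log-convexity of `m_k`. -/
def CondM3 (M : ℕ → ℝ) : Prop :=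
  ∀ k : ℕ, 1 ≤ k → (mseq M k) ^ 2 ≤ mseq M (k - 1) * mseq M (k + 1)

/-- Condition (M4): `m_k^(1/k) → ∞`. -/
def CondM4 (M : ℕ → ℝ) : Prop :=
  Filter.Tendsto (fun k : ℕ => (mseq M k) ^ ((1 : ℝ) / k)) Filter.atTop Filter.atTop

/-- A regular weight sequence. -/
structure IsRegularWeightSeq (M : ℕ → ℝ) extends IsWeightSeq M : Prop where
  m_one : mseq M 1 = 1
  cond2 : CondM2 M
  cond3 : CondM3 M
  cond4 : CondM4 M

/-- The associated weight `h_M(t) = inf_k t^k m_k`. -/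
noncomputable def weight_h (M : ℕ → ℝ) (t : ℝ) : ℝ := ⨅ k : ℕ, t ^ k * mseq M k

/-- The associated weight function `ω_M(t) = sup_j log (t^j / M_j)`. -/
noncomputable def weight_omega (M : ℕ → ℝ) (t : ℝ) : ℝ := ⨆ j : ℕ, Real.log (t ^ j / M j)

/-- Membership in the Denjoy-Carleman class `E_M(Ω)`: smooth on `Ω` and on every
compact `K ⊆ Ω` the iterated derivatives satisfy `‖D^k f‖ ≤ C h^k M_k`. -/
def MemDC (M : ℕ → ℝ) {n : ℕ} {E : Type*} [NormedAddCommGroup E] [NormedSpace ℝ E]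
    (Ω : Set (Fin n → ℝ)) (f : (Fin n → ℝ) → E) : Prop :=
  ContDiffOn ℝ (⊤ : ℕ∞) f Ω ∧
  ∀ K : Set (Fin n → ℝ), K ⊆ Ω → IsCompact K →
    ∃ C > 0, ∃ h > 0, ∀ k : ℕ, ∀ x ∈ K,
      ‖iteratedFDerivWithin ℝ k f Ω x‖ ≤ C * h ^ k * M k

/-- `h_1(t) = inf_{k ≥ 1} m_k t^(k-1)`. -/
noncomputable def weight_h1 (M : ℕ → ℝ) (t : ℝ) : ℝ := ⨅ k : ℕ, mseq M (k + 1) * t ^ k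

theorem IsWeightSeq.mseq_pos {M : ℕ → ℝ} (hM : IsWeightSeq M) (k : ℕ) : 0 < mseq M k :=
  div_pos (hM.pos k) (by exact_mod_cast Nat.factorial_pos k)

/-- Condition (M2) gives the geometric bound `m_{k+1} ≤ Q^k m_k`. -/
theorem IsRegularWeightSeq.exists_mseq_succ_le {M : ℕ → ℝ} (hM : IsRegularWeightSeq M) :
    ∃ Q : ℝ, 0 < Q ∧ ∀ k : ℕ, mseq M (k + 1) ≤ Q ^ k * mseq M k := by
  obtain ⟨C, hC⟩ := hM.cond2
  refine ⟨max C 1, by positivity, fun k => ?_⟩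
  rcases Nat.eq_zero_or_pos k with rfl | hk
  · have h0 : mseq M 0 = 1 := by simp [mseq, hM.one]
    simp [hM.m_one, h0]
  · have hpos := hM.mseq_pos
    have hr : 0 ≤ mseq M (k + 1) / mseq M k := (div_pos (hpos _) (hpos k)).le
    have h : (mseq M (k + 1) / mseq M k) ^ ((k : ℝ)⁻¹) ≤ max C 1 := by
      simpa only [one_div] using (hC k hk).trans (le_max_left C 1)
    rw [← div_le_iff₀ (hpos k), ← Real.rpow_inv_natCast_pow hr hk.ne']
    exact pow_le_pow_left₀ (Real.rpow_nonneg hr _) h k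

/-- For a regular weight sequence, `h_M(t) ≤ t·h_1(t)` for all `t > 0`, and there is
`Q > 0` with `h_1(t) ≤ h_M(Q t)` for all `t > 0`. -/
theorem stmt_2 (M : ℕ → ℝ) (hM : IsRegularWeightSeq M) :
    (∀ t : ℝ, 0 < t → weight_h M t ≤ t * weight_h1 M t) ∧
    ∃ Q : ℝ, 0 < Q ∧ ∀ t : ℝ, 0 < t → weight_h1 M t ≤ weight_h M (Q * t) := by
  have hpos := hM.mseq_pos
  refine ⟨fun t ht => ?_, ?_⟩
  · rw [weight_h1, Real.mul_iInf_of_nonneg ht.le]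
    refine le_ciInf fun k => ?_
    have hbdd : BddBelow (Set.range fun k : ℕ => t ^ k * mseq M k) :=
      ⟨0, Set.forall_mem_range.2 fun k => (mul_pos (pow_pos ht k) (hpos k)).le⟩
    exact (ciInf_le hbdd (k + 1)).trans_eq (by ring)
  · obtain ⟨Q, hQ, hle⟩ := hM.exists_mseq_succ_le
    refine ⟨Q, hQ, fun t ht => le_ciInf fun k => ?_⟩
    have hbdd : BddBelow (Set.range fun k : ℕ => mseq M (k + 1) * t ^ k) :=
      ⟨0, Set.forall_mem_range.2 fun k => (mul_pos (hpos (k + 1)) (pow_pos ht k)).le⟩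
    refine (ciInf_le hbdd k).trans ?_
    calc mseq M (k + 1) * t ^ k ≤ Q ^ k * mseq M k * t ^ k :=
          mul_le_mul_of_nonneg_right (hle k) (pow_pos ht k).le
      _ = (Q * t) ^ k * mseq M k := by ring
end

section
/- Let (M_j)_{j≥0} be a weight sequence satisfying condition (M2), let Ω ⊆ ℝⁿ be open and convex, let 1 ≤ j ≤ n, and let a ∈ ℝ be such that for every x ∈ Ω the point obtained from x by replacing its j-th coordinate by a also lies in Ω. Suppose f ∈ E_M(Ω) satisfies f(x) = 0 for every x ∈ Ω whose j-th coordinate equals a. Then there exists g ∈ E_M(Ω) such that f(x) = (x_j − a)·g(x) for all x ∈ Ω. -/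
open scoped Topology
open Filter

open Set MeasureTheory in
/-- Differentiation under the integral sign over `[0, 1]`, with jointly continuous derivative. -/
theorem hasFDerivAt_intervalIntegral_of_continuousOn
    {E G : Type*} [NormedAddCommGroup E] [NormedSpace ℝ E] [ProperSpace E]
    [NormedAddCommGroup G] [NormedSpace ℝ G]
    {Ω : Set E} (hΩ : IsOpen Ω) {P : ℝ → E → G} {P' : ℝ → E → E →L[ℝ] G}
    (hP : ContinuousOn (Function.uncurry P) (Icc 0 1 ×ˢ Ω))
    (hP' : ContinuousOn (Function.uncurry P') (Icc 0 1 ×ˢ Ω))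
    (hderiv : ∀ t ∈ Icc (0 : ℝ) 1, ∀ x ∈ Ω, HasFDerivAt (P t) (P' t x) x)
    {x₀ : E} (hx₀ : x₀ ∈ Ω) :
    HasFDerivAt (fun x => ∫ t in (0 : ℝ)..1, P t x) (∫ t in (0 : ℝ)..1, P' t x₀) x₀ := by
  obtain ⟨r, hr, hball⟩ := Metric.nhds_basis_closedBall.mem_iff.1 (hΩ.mem_nhds hx₀)
  obtain ⟨B, hB⟩ := ((isCompact_Icc (a := (0 : ℝ)) (b := 1)).prod
    (isCompact_closedBall x₀ r)).exists_bound_of_continuousOn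
      (hP'.mono (prod_mono subset_rfl hball))
  have hslice : ∀ x ∈ Ω, ContinuousOn (fun t => P t x) (Icc 0 1) := fun x hx =>
    hP.comp (f := fun t : ℝ => (t, x)) (by fun_prop) fun t ht => ⟨ht, hx⟩
  have hslice' : ContinuousOn (fun t => P' t x₀) (Icc 0 1) :=
    hP'.comp (f := fun t : ℝ => (t, x₀)) (by fun_prop) fun t ht => ⟨ht, hx₀⟩
  have hsub : uIoc (0 : ℝ) 1 ⊆ Icc 0 1 := by
    rw [uIoc_of_le zero_le_one]; exact Ioc_subset_Icc_self
  refine intervalIntegral.hasFDerivAt_integral_of_dominated_of_fderiv_le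
    (F := fun x t => P t x) (F' := fun x t => P' t x) (bound := fun _ => B)
    (Metric.closedBall_mem_nhds x₀ hr) ?_ ?_ ?_ ?_ intervalIntegrable_const ?_
  · filter_upwards [hΩ.mem_nhds hx₀] with x hx
    exact ((hslice x hx).mono hsub).aestronglyMeasurable measurableSet_uIoc
  · exact (hslice x₀ hx₀).intervalIntegrable_of_Icc zero_le_one
  · exact (hslice'.mono hsub).aestronglyMeasurable measurableSet_uIoc
  · exact ae_of_all _ fun t ht x hx => hB (t, x) ⟨hsub ht, hx⟩
  · exact ae_of_all _ fun t ht x hx => hderiv t (hsub ht) x (hball hx)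

open Set in
/-- Averaging a smooth function along a continuous family of affine self-maps `x ↦ L t x + c t`
of an open set yields a smooth function, whose Taylor series is obtained by integration. -/
theorem HasFTaylorSeriesUpToOn.intervalIntegral_comp_affine
    {E G : Type*} [NormedAddCommGroup E] [NormedSpace ℝ E] [ProperSpace E]
    [NormedAddCommGroup G] [NormedSpace ℝ G] [CompleteSpace G]
    {Ω : Set E} (hΩ : IsOpen Ω) {F : E → G} {q : E → FormalMultilinearSeries ℝ E G}
    (hq : HasFTaylorSeriesUpToOn (⊤ : ℕ∞) F q Ω) {L : ℝ → E →L[ℝ] E} {c : ℝ → E}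
    (hL : Continuous L) (hc : Continuous c)
    (hmaps : ∀ t ∈ Icc (0 : ℝ) 1, ∀ x ∈ Ω, L t x + c t ∈ Ω) :
    HasFTaylorSeriesUpToOn (⊤ : ℕ∞) (fun x => ∫ t in (0 : ℝ)..1, F (L t x + c t))
      (fun x k => ∫ t in (0 : ℝ)..1,
        (q (L t x + c t) k).compContinuousLinearMap fun _ => L t) Ω := by
  have hφ : Continuous fun z : ℝ × E => L z.1 z.2 + c z.1 := by fun_prop
  have hcont (k : ℕ) : ContinuousOn (fun z : ℝ × E =>
      (q (L z.1 z.2 + c z.1) k).compContinuousLinearMap fun _ => L z.1) (Icc 0 1 ×ˢ Ω) := by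
    have h₁ : ContinuousOn (fun z : ℝ × E => q (L z.1 z.2 + c z.1) k) (Icc 0 1 ×ˢ Ω) :=
      (hq.cont k (by exact_mod_cast le_top)).comp hφ.continuousOn
        fun z hz => hmaps z.1 hz.1 z.2 hz.2
    have h₂ : Continuous fun z : ℝ × E =>
        ContinuousMultilinearMap.compContinuousLinearMapContinuousMultilinear ℝ
          (fun _ : Fin k => E) (fun _ : Fin k => E) G fun _ => L z.1 :=
      (ContinuousMultilinearMap.cont _).comp (by fun_prop)
    exact h₂.continuousOn.clm_apply h₁
  have hcont' (k : ℕ) : ContinuousOn (fun z : ℝ × E =>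
      ((q (L z.1 z.2 + c z.1) (k + 1)).compContinuousLinearMap fun _ => L z.1).curryLeft)
      (Icc 0 1 ×ˢ Ω) :=
    (continuousMultilinearCurryLeftEquiv ℝ (fun _ : Fin (k + 1) => E) G).continuous.comp_continuousOn
      (hcont (k + 1))
  refine (hasFTaylorSeriesUpToOn_top_iff' le_rfl).2 ⟨fun x hx => ?_, fun k x hx => ?_⟩
  · have h := (continuousMultilinearCurryFin0 ℝ E G).toContinuousLinearEquiv.integral_comp_comm
      (μ := MeasureTheory.volume.restrict (Ioc (0 : ℝ) 1))
      fun t => (q (L t x + c t) 0).compContinuousLinearMap fun _ => L t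
    simp only [intervalIntegral.integral_of_le zero_le_one]
    refine h.symm.trans (MeasureTheory.setIntegral_congr_fun measurableSet_Ioc fun t ht => ?_)
    have := hq.zero_eq _ (hmaps t (Ioc_subset_Icc_self ht) x hx)
    rw [← this]
    simp [ContinuousMultilinearMap.curry0]
    congr!
  · have h := hasFDerivAt_intervalIntegral_of_continuousOn hΩ
      (P := fun t x => (q (L t x + c t) k).compContinuousLinearMap fun _ => L t)
      (P' := fun t x => ((q (L t x + c t) (k + 1)).compContinuousLinearMap fun _ => L t).curryLeft)
      (hcont k) (hcont' k) (fun t ht y hy => ?_) hx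
    · let Φ : (E [×(k + 1)]→L[ℝ] G) ≃L[ℝ] (E →L[ℝ] E [×k]→L[ℝ] G) :=
        (continuousMultilinearCurryLeftEquiv ℝ (fun _ : Fin (k + 1) => E)
          G).toContinuousLinearEquiv
      have hI := ContinuousLinearEquiv.integral_comp_comm (𝕜 := ℝ) (E := E [×(k + 1)]→L[ℝ] G)
        (F := E →L[ℝ] E [×k]→L[ℝ] G) Φ
        (μ := MeasureTheory.volume.restrict (Ioc (0 : ℝ) 1))
        fun t => (q (L t x + c t) (k + 1)).compContinuousLinearMap fun _ => L t
      simp only [intervalIntegral.integral_of_le zero_le_one] at h ⊢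
      exact (h.congr_fderiv hI).hasFDerivWithinAt
    · have hy' := hmaps t ht y hy
      have hd : HasFDerivAt (fun z => q z k) (q (L t y + c t) (k + 1)).curryLeft (L t y + c t) :=
        (hq.fderivWithin k (by exact_mod_cast ENat.natCast_lt_top k) _ hy').hasFDerivAt
          (hΩ.mem_nhds hy')
      have hA : HasFDerivAt (fun z => L t z + c t) (L t) y := (L t).hasFDerivAt.add_const _
      have hC := (ContinuousMultilinearMap.compContinuousLinearMapL (𝕜 := ℝ) (F := G)
        fun _ : Fin k => L t).hasFDerivAt.comp y (hd.comp y hA)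
      refine hC.congr_fderiv ?_
      ext v m
      simp
      congr 1
      ext i
      refine Fin.cases ?_ (fun i => ?_) i <;> simp

/-- Condition (M2) bounds `M (k + 1)` geometrically in terms of `M k`. -/
theorem CondM2.exists_le_mul_pow {M : ℕ → ℝ} (hM : IsWeightSeq M) (h2 : CondM2 M) :
    ∃ A > 0, ∃ B > 0, ∀ k, M (k + 1) ≤ A * B ^ k * M k := by
  obtain ⟨C, hC⟩ := h2
  have hm (k : ℕ) : 0 < mseq M k := div_pos (hM.pos k) (by positivity)
  set D := max C 1
  have hD : 0 < D := lt_max_of_lt_right one_pos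
  refine ⟨max (M 1) 1, lt_max_of_lt_right one_pos, 2 * D, by positivity, fun k => ?_⟩
  rcases Nat.eq_zero_or_pos k with rfl | hk
  · simp [hM.one]
  have hratio : mseq M (k + 1) / mseq M k ≤ D ^ k := by
    have h₀ : 0 ≤ mseq M (k + 1) / mseq M k := (div_pos (hm _) (hm _)).le
    calc mseq M (k + 1) / mseq M k
        = ((mseq M (k + 1) / mseq M k) ^ ((1 : ℝ) / k)) ^ k := by
          rw [one_div, Real.rpow_inv_natCast_pow h₀ hk.ne']
      _ ≤ D ^ k := pow_le_pow_left₀ (Real.rpow_nonneg h₀ _) ((hC k hk).trans (le_max_left _ _)) k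
  have hstep : M (k + 1) ≤ (k + 1) * D ^ k * M k := by
    rw [div_le_iff₀ (hm k), mseq, mseq, Nat.factorial_succ] at hratio
    have hf : (0 : ℝ) < k.factorial := by positivity
    push_cast at hratio
    rw [div_le_iff₀ (by positivity)] at hratio
    calc M (k + 1) ≤ _ := hratio
      _ = _ := by field_simp
  have hk2 : (k : ℝ) + 1 ≤ 2 ^ k := by exact_mod_cast Nat.lt_two_pow_self
  have hMk := hM.pos k
  calc M (k + 1) ≤ (k + 1) * D ^ k * M k := hstep
    _ ≤ 2 ^ k * D ^ k * M k := by gcongr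
    _ = 1 * (2 * D) ^ k * M k := by rw [mul_pow, one_mul]
    _ ≤ _ := by gcongr; exact le_max_right _ _

/-- The linear map multiplying the `j`-th coordinate by `t` and fixing the other ones. -/
noncomputable def coordScale {n : ℕ} (j : Fin n) (t : ℝ) : (Fin n → ℝ) →L[ℝ] (Fin n → ℝ) :=
  ContinuousLinearMap.id ℝ _ +
    (t - 1) • (ContinuousLinearMap.proj (R := ℝ) (φ := fun _ : Fin n => ℝ) j).smulRight
      (Pi.single j (1 : ℝ) : Fin n → ℝ)

theorem coordScale_apply {n : ℕ} (j : Fin n) (t : ℝ) (x : Fin n → ℝ) :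
    coordScale j t x = Function.update x j (t * x j) := by
  ext i
  rcases eq_or_ne i j with rfl | h
  · simp [coordScale]; ring
  · simp [coordScale, h]

theorem continuous_coordScale {n : ℕ} (j : Fin n) : Continuous (coordScale j) := by
  unfold coordScale
  fun_prop

theorem norm_coordScale_le {n : ℕ} (j : Fin n) {t : ℝ} (ht : t ∈ Set.Icc (0 : ℝ) 1) :
    ‖coordScale j t‖ ≤ 1 := by
  refine ContinuousLinearMap.opNorm_le_bound _ zero_le_one fun x => ?_
  rw [one_mul, coordScale_apply, pi_norm_le_iff_of_nonneg (norm_nonneg _)]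
  intro i
  rcases eq_or_ne i j with rfl | h
  · rw [Function.update_self, norm_mul, Real.norm_of_nonneg ht.1]
    exact (mul_le_of_le_one_left (norm_nonneg _) ht.2).trans (norm_le_pi_norm x i)
  · simpa [h] using norm_le_pi_norm x i

theorem coordScale_add_single {n : ℕ} (j : Fin n) (a t : ℝ) (x : Fin n → ℝ) :
    coordScale j t x + Pi.single j ((1 - t) * a) =
      (1 - t) • Function.update x j a + t • x := by
  ext i
  rcases eq_or_ne i j with rfl | h
  · simp [coordScale_apply]; ring
  · simp [coordScale_apply, h]; ring

open Set in
/-- Closedness under division by a coordinate: if `f ∈ E_M(Ω)` vanishes on the slice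
`{x ∈ Ω | x j = a}`, then `f(x) = (x_j − a) g(x)` with `g ∈ E_M(Ω)`. -/
theorem stmt_3 (M : ℕ → ℝ) (hM : IsWeightSeq M) (h2 : CondM2 M)
    {n : ℕ} (Ω : Set (Fin n → ℝ)) (hΩ : IsOpen Ω) (hconv : Convex ℝ Ω)
    (j : Fin n) (a : ℝ)
    (hslice : ∀ x ∈ Ω, Function.update x j a ∈ Ω)
    (f : (Fin n → ℝ) → ℂ) (hf : MemDC M Ω f)
    (hvan : ∀ x ∈ Ω, x j = a → f x = 0) :
    ∃ g : (Fin n → ℝ) → ℂ, MemDC M Ω g ∧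
      ∀ x ∈ Ω, f x = ((x j - a : ℝ) : ℂ) * g x := by
  obtain ⟨hsmooth, hbound⟩ := hf
  have hu : UniqueDiffOn ℝ Ω := hΩ.uniqueDiffOn
  set e : Fin n → ℝ := Pi.single j 1
  set φ : ℝ → (Fin n → ℝ) → (Fin n → ℝ) := fun t x => coordScale j t x + Pi.single j ((1 - t) * a)
    with hφ
  set F : (Fin n → ℝ) → ℂ := fun x => fderivWithin ℝ f Ω x e
  have hcs : Continuous fun t : ℝ => (Pi.single j ((1 - t) * a) : Fin n → ℝ) :=
    (continuous_single j).comp (by fun_prop)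
  have hcφ : Continuous fun z : ℝ × (Fin n → ℝ) => φ z.1 z.2 := by
    have := continuous_coordScale j
    have := hcs.comp (continuous_fst (X := ℝ) (Y := Fin n → ℝ))
    simp only [hφ]
    fun_prop
  have hmaps : ∀ t ∈ Icc (0 : ℝ) 1, ∀ x ∈ Ω, φ t x ∈ Ω := fun t ht x hx => by
    simp only [hφ, coordScale_add_single]
    exact hconv (hslice x hx) hx (by linarith [ht.2]) ht.1 (by ring)
  have hDf : ContDiffOn ℝ (⊤ : ℕ∞) (fderivWithin ℝ f Ω) Ω :=
    hsmooth.fderivWithin hu (by exact_mod_cast le_top)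
  have hF : ContDiffOn ℝ (⊤ : ℕ∞) F Ω := hDf.clm_apply contDiffOn_const
  have hT := (hF.ftaylorSeriesWithin hu).intervalIntegral_comp_affine hΩ
    (continuous_coordScale j) hcs hmaps
  refine ⟨fun x => ∫ t in (0 : ℝ)..1, F (φ t x), ⟨fun x hx => hT.contDiffOn x hx, fun K hK hKc => ?_⟩,
    fun x hx => ?_⟩
  · obtain ⟨C, hC, h, hh, hCh⟩ := hbound ((fun z : ℝ × (Fin n → ℝ) => φ z.1 z.2) '' (Icc 0 1 ×ˢ K))
      (by rintro _ ⟨z, hz, rfl⟩; exact hmaps z.1 hz.1 z.2 (hK hz.2))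
      ((isCompact_Icc.prod hKc).image hcφ)
    obtain ⟨A, hA, B, hB, hAB⟩ := h2.exists_le_mul_pow hM
    refine ⟨C * h * A, by positivity, h * B, by positivity, fun k x hx => ?_⟩
    rw [← hT.eq_iteratedFDerivWithin_of_uniqueDiffOn (by exact_mod_cast le_top) hu (hK hx)]
    refine (intervalIntegral.norm_integral_le_of_norm_le_const
      (C := C * h * A * (h * B) ^ k * M k) fun t ht => ?_).trans (by simp)
    rw [uIoc_of_le zero_le_one] at ht
    have ht' := Ioc_subset_Icc_self ht
    have hx' := hmaps t ht' x (hK hx)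
    have hprod : ∏ _i : Fin k, ‖coordScale j t‖ ≤ 1 :=
      Finset.prod_le_one (fun _ _ => norm_nonneg _) fun _ _ => norm_coordScale_le j ht'
    calc _ ≤ ‖iteratedFDerivWithin ℝ k F Ω (φ t x)‖ * ∏ _i : Fin k, ‖coordScale j t‖ :=
          ContinuousMultilinearMap.norm_compContinuousLinearMap_le _ _
      _ ≤ ‖iteratedFDerivWithin ℝ k F Ω (φ t x)‖ := mul_le_of_le_one_right (norm_nonneg _) hprod
      _ ≤ ‖e‖ * ‖iteratedFDerivWithin ℝ k (fderivWithin ℝ f Ω) Ω (φ t x)‖ :=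
          norm_iteratedFDerivWithin_clm_apply_const (hDf _ hx') hu hx' (by exact_mod_cast le_top)
      _ = ‖iteratedFDerivWithin ℝ (k + 1) f Ω (φ t x)‖ := by
          rw [norm_iteratedFDerivWithin_fderivWithin hu hx', Pi.norm_single, norm_one, one_mul]
      _ ≤ C * h ^ (k + 1) * M (k + 1) := hCh _ _ ⟨(t, x), ⟨ht', hx⟩, rfl⟩
      _ ≤ C * h ^ (k + 1) * (A * B ^ k * M k) := by gcongr; exact hAB k
      _ = _ := by ring
  · have hline : ∀ t : ℝ, HasDerivAt (fun s => φ s x) ((x j - a) • e) t := fun t => by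
      have h₁ : (fun s => φ s x) = fun s => Function.update x j a + s • ((x j - a) • e) := by
        funext s
        ext i
        simp only [hφ, coordScale_add_single]
        rcases eq_or_ne i j with rfl | h
        · simp [e]; ring
        · simp [e, h]; ring
      rw [h₁]
      simpa using ((hasDerivAt_id t).smul_const ((x j - a) • e)).const_add (Function.update x j a)
    have hderiv : ∀ t ∈ uIcc (0 : ℝ) 1,
        HasDerivAt (fun s => f (φ s x)) ((x j - a) • F (φ t x)) t := fun t ht => by
      rw [uIcc_of_le zero_le_one] at ht
      have hx' := hmaps t ht x hx
      have hd := ((hsmooth.differentiableOn (by simp)) _ hx').hasFDerivWithinAt.hasFDerivAt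
        (hΩ.mem_nhds hx')
      have := hd.comp_hasDerivAt t (hline t)
      rwa [map_smul] at this
    have hcF : ContinuousOn (fun t => F (φ t x)) (Icc 0 1) :=
      hF.continuousOn.comp (f := fun t => φ t x)
        (hcφ.comp (Continuous.prodMk_left x)).continuousOn fun t ht => hmaps t ht x hx
    have hint := intervalIntegral.integral_eq_sub_of_hasDerivAt hderiv
      ((hcF.const_smul (x j - a)).intervalIntegrable_of_Icc zero_le_one)
    have h₁ : φ 1 x = x := by simp [hφ, coordScale_add_single]
    have h₀ : f (φ 0 x) = 0 := by
      simpa [hφ, coordScale_add_single] using hvan _ (hslice x hx) (by simp)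
    rw [intervalIntegral.integral_smul, h₁, h₀, sub_zero, Complex.real_smul] at hint
    exact hint.symm
end

section
/- Let (M_j)_{j≥0} and (N_j)_{j≥0} be weight sequences and let Ω ⊆ ℝⁿ be a nonempty open set. Then E_M(Ω) ⊆ E_N(Ω) if and only if sup_{k≥1} (M_k/N_k)^{1/k} < ∞. -/
open scoped Topology
open Filter

/-- Supporting line inequality for log-convex sequences. -/
lemma IsWeightSeq.div_pow_mul_pow_ratio_le {M : ℕ → ℝ} (hM : IsWeightSeq M) (j k : ℕ) :
    M k / (M (k + 1) / M k) ^ k * (M (k + 1) / M k) ^ j ≤ M j := by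
  have hpos : ∀ i, 0 < M (i + 1) / M i := fun i => div_pos (hM.pos _) (hM.pos _)
  have hmono : Monotone fun i => M (i + 1) / M i := by
    refine monotone_nat_of_le_succ fun i => ?_
    rw [div_le_div_iff₀ (hM.pos _) (hM.pos _)]
    have := hM.logConvex (i + 1) (by omega)
    simp only [Nat.add_sub_cancel] at this
    nlinarith
  have hk := hpos k
  have hstep : ∀ i, M (i + 1) = M i * (M (i + 1) / M i) := fun i => by
    have := (hM.pos i).ne'
    field_simp
  rw [div_mul_eq_mul_div, div_le_iff₀ (pow_pos hk k)]
  rcases le_total k j with hkj | hjk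
  · induction j, hkj using Nat.le_induction with
    | base => rfl
    | succ j hkj ih =>
      calc M k * (M (k + 1) / M k) ^ (j + 1)
          = M k * (M (k + 1) / M k) ^ j * (M (k + 1) / M k) := by ring
        _ ≤ M j * (M (k + 1) / M k) ^ k * (M (j + 1) / M j) :=
            mul_le_mul ih (hmono hkj) hk.le (mul_pos (hM.pos j) (pow_pos hk k)).le
        _ = M j * (M (j + 1) / M j) * (M (k + 1) / M k) ^ k := by ring
        _ = M (j + 1) * (M (k + 1) / M k) ^ k := by rw [← hstep]
  · induction hjk using Nat.decreasingInduction with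
    | self => rfl
    | of_succ j hjk ih =>
      have hle : M (j + 1) / M j ≤ M (k + 1) / M k := hmono (by omega : j ≤ k)
      refine le_of_mul_le_mul_right ?_ hk
      calc M k * (M (k + 1) / M k) ^ j * (M (k + 1) / M k)
          = M k * (M (k + 1) / M k) ^ (j + 1) := by ring
        _ ≤ M (j + 1) * (M (k + 1) / M k) ^ k := ih
        _ = M j * (M (k + 1) / M k) ^ k * (M (j + 1) / M j) := by
            rw [mul_right_comm, ← hstep]
        _ ≤ M j * (M (k + 1) / M k) ^ k * (M (k + 1) / M k) :=
            mul_le_mul_of_nonneg_left hle (mul_pos (hM.pos j) (pow_pos hk k)).le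

lemma iteratedDeriv_const_mul_cexp (a b : ℂ) (s : ℝ) (j : ℕ) :
    iteratedDeriv j (fun t : ℝ => a * Complex.exp (b * (t - s))) =
      fun t : ℝ => a * b ^ j * Complex.exp (b * (t - s)) := by
  induction j with
  | zero => simp
  | succ j ih =>
    rw [iteratedDeriv_succ, ih]
    ext t
    have h : HasDerivAt (fun t : ℝ => b * ((t : ℂ) - s)) (b * 1) t :=
      ((Complex.ofRealCLM.hasDerivAt (x := t)).sub_const (s : ℂ)).const_mul b
    rw [(h.cexp.const_mul (a * b ^ j)).deriv]
    ring

/-- Every weight sequence has a function on the line satisfying the estimates of its class globally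
whose derivatives at a given point are at least as large as the sequence. -/
lemma IsWeightSeq.exists_characteristic {M : ℕ → ℝ} (hM : IsWeightSeq M) (s : ℝ) :
    ∃ g : ℝ → ℂ, ContDiff ℝ (⊤ : ℕ∞) g ∧
      (∀ j t, ‖iteratedDeriv j g t‖ ≤ 2 * 2 ^ j * M j) ∧
      ∀ j, M j ≤ ‖iteratedDeriv j g s‖ := by
  let r : ℕ → ℝ := fun k => 2 * (M (k + 1) / M k)
  let c : ℕ → ℝ := fun k => M k / r k ^ k
  let F : ℕ → ℝ → ℂ := fun k t => c k * Complex.exp (r k * Complex.I * (t - s))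
  have hr : ∀ k, 0 < r k := fun k => mul_pos two_pos (div_pos (hM.pos _) (hM.pos _))
  have hc : ∀ k, 0 < c k := fun k => div_pos (hM.pos k) (pow_pos (hr k) k)
  have hderiv : ∀ k j, iteratedDeriv j (F k) =
      fun t : ℝ => c k * (r k * Complex.I) ^ j * Complex.exp (r k * Complex.I * (t - s)) :=
    fun k j => iteratedDeriv_const_mul_cexp _ _ s j
  have hnorm : ∀ k j t, ‖iteratedDeriv j (F k) t‖ = c k * r k ^ j := fun k j t => by
    have : (r k * Complex.I * (t - s) : ℂ) = ((r k * (t - s) : ℝ) : ℂ) * Complex.I := by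
      push_cast; ring
    rw [hderiv]
    simp only [this, norm_mul, norm_pow, Complex.norm_exp_ofReal_mul_I, Complex.norm_I,
      Complex.norm_real, Real.norm_of_nonneg (hr k).le, Real.norm_of_nonneg (hc k).le, mul_one]
  have hbound : ∀ j k, c k * r k ^ j ≤ 2 ^ j * M j * (1 / 2) ^ k := fun j k => by
    have h := mul_le_mul_of_nonneg_left (hM.div_pow_mul_pow_ratio_le j k)
      (by positivity : (0 : ℝ) ≤ 2 ^ j * (1 / 2) ^ k)
    calc c k * r k ^ j
        = 2 ^ j * (1 / 2) ^ k * (M k / (M (k + 1) / M k) ^ k * (M (k + 1) / M k) ^ j) := by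
          simp only [c, r, mul_pow, inv_pow, div_eq_mul_inv, mul_inv]
          ring
      _ ≤ 2 ^ j * (1 / 2) ^ k * M j := h
      _ = 2 ^ j * M j * (1 / 2) ^ k := by ring
  have hgeom : ∀ j, Summable fun k : ℕ => 2 ^ j * M j * (1 / 2 : ℝ) ^ k := fun j =>
    summable_geometric_two.mul_left _
  have hsum : ∀ j, Summable fun k => c k * r k ^ j := fun j =>
    (hgeom j).of_nonneg_of_le (fun k => (mul_pos (hc k) (pow_pos (hr k) j)).le) (hbound j)
  have hF : ∀ k, ContDiff ℝ (⊤ : ℕ∞) (F k) := fun k => by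
    have : ContDiff ℝ (⊤ : ℕ∞) (fun t : ℝ => (t : ℂ)) := Complex.ofRealCLM.contDiff
    exact contDiff_const.mul ((contDiff_const.mul (this.sub contDiff_const)).cexp)
  have hFn : ∀ j k t, ‖iteratedFDeriv ℝ j (F k) t‖ ≤ c k * r k ^ j := fun j k t => by
    rw [norm_iteratedFDeriv_eq_norm_iteratedDeriv, hnorm]
  have hD : ∀ j t, iteratedDeriv j (fun t => ∑' k, F k t) t = ∑' k, iteratedDeriv j (F k) t :=
    fun j t => by
      have hs : Summable fun k => iteratedFDeriv ℝ j (F k) t :=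
        (hsum j).of_norm_bounded fun k => hFn j k t
      have h := iteratedFDeriv_tsum_apply hF (fun i _ => hsum i)
        (fun i k t _ => hFn i k t) (le_top : (j : ℕ∞) ≤ ⊤) t
      simp only [iteratedDeriv_eq_iteratedFDeriv]
      rw [h]
      exact ContinuousMultilinearMap.tsum_eval hs _
  refine ⟨fun t => ∑' k, F k t,
    contDiff_tsum hF (fun i _ => hsum i) (fun i k t _ => hFn i k t), fun j t => ?_, fun j => ?_⟩
  · rw [hD]
    calc ‖∑' k, iteratedDeriv j (F k) t‖ ≤ ∑' k : ℕ, 2 ^ j * M j * (1 / 2 : ℝ) ^ k :=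
          tsum_of_norm_bounded (hgeom j).hasSum fun k => (hnorm k j t).trans_le (hbound j k)
      _ = 2 * 2 ^ j * M j := by rw [tsum_mul_left, tsum_geometric_two]; ring
  · have hs : ∑' k, iteratedDeriv j (F k) s = Complex.I ^ j * ((∑' k, c k * r k ^ j : ℝ) : ℂ) := by
      rw [Complex.ofReal_tsum, ← tsum_mul_left]
      refine tsum_congr fun k => ?_
      rw [hderiv]
      simp only [sub_self, mul_zero, Complex.exp_zero]
      push_cast
      ring
    have hnn : ∀ k, 0 ≤ c k * r k ^ j := fun k => (mul_pos (hc k) (pow_pos (hr k) j)).le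
    rw [hD, hs, norm_mul, norm_pow, Complex.norm_I, one_pow, one_mul, Complex.norm_real,
      Real.norm_of_nonneg (tsum_nonneg hnn)]
    calc M j = c j * r j ^ j := (div_mul_cancel₀ _ (pow_pos (hr j) j).ne').symm
      _ ≤ ∑' k, c k * r k ^ j := (hsum j).le_tsum j fun k _ => hnn k

/-- Inclusion of Denjoy-Carleman classes: `E_M(Ω) ⊆ E_N(Ω)` iff
`sup_{k≥1} (M_k/N_k)^(1/k) < ∞`. -/
theorem stmt_6 (M N : ℕ → ℝ) (hM : IsWeightSeq M) (hN : IsWeightSeq N)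
    {n : ℕ} (hn : 0 < n) (Ω : Set (Fin n → ℝ)) (hΩ : IsOpen Ω) (hne : Ω.Nonempty) :
    (∀ f : (Fin n → ℝ) → ℂ, MemDC M Ω f → MemDC N Ω f) ↔
    ∃ C : ℝ, ∀ k : ℕ, 1 ≤ k → (M k / N k) ^ ((1 : ℝ) / k) ≤ C := by
  constructor
  · intro h
    obtain ⟨a, ha⟩ := hne
    let i₀ : Fin n := ⟨0, hn⟩
    obtain ⟨g, hg, hub, hlb⟩ := hM.exists_characteristic (a i₀)
    let p : (Fin n → ℝ) →L[ℝ] ℝ := ContinuousLinearMap.proj i₀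
    have hp : ‖p‖ ≤ 1 := p.opNorm_le_bound zero_le_one fun x => by
      simpa [p] using norm_le_pi_norm x i₀
    have hcomp : ∀ j, ∀ x ∈ Ω, iteratedFDerivWithin ℝ j (g ∘ p) Ω x =
        (iteratedFDeriv ℝ j g (p x)).compContinuousLinearMap fun _ => p := fun j x hx => by
      rw [iteratedFDerivWithin_of_isOpen j hΩ hx]
      exact p.iteratedFDeriv_comp_right hg x (by exact_mod_cast le_top)
    obtain ⟨-, hN'⟩ := h (g ∘ p) ⟨(hg.comp p.contDiff).contDiffOn, fun K hK _ =>
      ⟨2, two_pos, 2, two_pos, fun j x hx => by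
        rw [hcomp j x (hK hx)]
        calc _ ≤ ‖iteratedFDeriv ℝ j g (p x)‖ * ∏ _i : Fin j, ‖p‖ :=
              ContinuousMultilinearMap.norm_compContinuousLinearMap_le _ _
          _ ≤ ‖iteratedFDeriv ℝ j g (p x)‖ * 1 := by
              refine mul_le_mul_of_nonneg_left ?_ (norm_nonneg _)
              rw [Finset.prod_const]
              exact pow_le_one₀ (norm_nonneg p) hp
          _ ≤ 2 * 2 ^ j * M j := by
              rw [mul_one, norm_iteratedFDeriv_eq_norm_iteratedDeriv]
              exact hub j _⟩⟩
    obtain ⟨C, hC, b, hb, hle⟩ := hN' {a} (by simpa using ha) isCompact_singleton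
    have key : ∀ k, M k ≤ C * b ^ k * N k := fun k => by
      refine le_trans ?_ (hle k a rfl)
      have hev := (iteratedFDerivWithin ℝ k (g ∘ p) Ω a).le_opNorm
        fun _ => Pi.single i₀ (1 : ℝ)
      refine le_trans (hlb k) ?_
      rw [hcomp k a ha] at hev ⊢
      have hnorm : ‖(Pi.single i₀ (1 : ℝ) : Fin n → ℝ)‖ = 1 := by
        rw [Pi.norm_single, norm_one]
      simpa [p, iteratedDeriv_eq_iteratedFDeriv, hnorm] using hev
    refine ⟨max C 1 * b, fun k hk => ?_⟩
    have hk0 : k ≠ 0 := by omega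
    have hm : 0 ≤ max C 1 * b := by positivity
    rw [one_div]
    refine (Real.rpow_inv_le_iff_of_pos (div_pos (hM.pos k) (hN.pos k)).le hm
      (by positivity)).2 ?_
    rw [Real.rpow_natCast, div_le_iff₀ (hN.pos k), mul_pow]
    refine (key k).trans ?_
    have : C ≤ max C 1 ^ k := (le_max_left C 1).trans (le_self_pow₀ (le_max_right C 1) hk0)
    have := (hN.pos k).le
    gcongr
  · rintro ⟨C, hC⟩ f ⟨hf, hfM⟩
    have hC0 : 0 < C := (Real.rpow_pos_of_pos (div_pos (hM.pos 1) (hN.pos 1)) _).trans_le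
      (hC 1 le_rfl)
    have key : ∀ k, M k ≤ C ^ k * N k := fun k => by
      rcases Nat.eq_zero_or_pos k with rfl | hk
      · simp [hM.one, hN.one]
      · have h := hC k hk
        rw [one_div, Real.rpow_inv_le_iff_of_pos (div_pos (hM.pos k) (hN.pos k)).le hC0.le
          (by positivity), Real.rpow_natCast, div_le_iff₀ (hN.pos k)] at h
        exact h
    refine ⟨hf, fun K hK hKc => ?_⟩
    obtain ⟨A, hA, b, hb, hle⟩ := hfM K hK hKc
    refine ⟨A, hA, b * C, mul_pos hb hC0, fun k x hx => (hle k x hx).trans ?_⟩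
    calc A * b ^ k * M k ≤ A * b ^ k * (C ^ k * N k) :=
          mul_le_mul_of_nonneg_left (key k) (by positivity)
      _ = A * (b * C) ^ k * N k := by rw [mul_pow]; ring
end

section
/- (Denjoy–Carleman theorem) Let (M_j)_{j≥0} be a weight sequence and let Ω ⊆ ℝⁿ be open. Then the class E_M(Ω) is quasianalytic — i.e., for every f ∈ E_M(Ω), if all partial derivatives D^α f vanish at some point p ∈ Ω then f is identically zero on the connected component of Ω containing p — if and only if the series Σ_{k≥1} M_{k−1}/M_k diverges. -/
open scoped Topology
open Filter

/-- `E_M(Ω)` is quasianalytic: any `f ∈ E_M(Ω)` all of whose derivatives vanish at a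
point `p ∈ Ω` vanishes on the connected component of `Ω` containing `p`. -/
def Quasianalytic (M : ℕ → ℝ) {n : ℕ} (Ω : Set (Fin n → ℝ)) : Prop :=
  ∀ f : (Fin n → ℝ) → ℂ, MemDC M Ω f → ∀ p ∈ Ω,
    (∀ k : ℕ, iteratedFDerivWithin ℝ k f Ω p = 0) →
    ∀ x ∈ connectedComponentIn Ω p, f x = 0

section Bang

variable {M : ℕ → ℝ} {F : ℕ → ℝ → ℂ} {b : ℝ}

/-- Bang's propagation estimate: smallness of the first `N + 1` derivatives at `x`, relative to
`exp (n - (N + 1)) * M n`, yields smallness of the first `N` derivatives at nearby points. -/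
theorem bang_propagation (hpos : ∀ k, 0 < M k)
    (hmono : Monotone fun k => M (k + 1) / M k)
    (hF : ∀ k, ∀ t ∈ Set.Icc 0 b, HasDerivWithinAt (F k) (F (k + 1) t) (Set.Icc 0 b) t)
    (hbd : ∀ k, ∀ t ∈ Set.Icc 0 b, ‖F k t‖ ≤ M k) {N : ℕ} {x y : ℝ}
    (hx0 : 0 ≤ x) (hxy : x ≤ y) (hyb : y ≤ b)
    (hstep : y - x ≤ M N / M (N + 1) / Real.exp 1)
    (hx : ∀ n < N + 1, ‖F n x‖ ≤ Real.exp (n - (N + 1)) * M n) :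
    ∀ n < N, ‖F n y‖ ≤ Real.exp (n - N) * M n := by
  set ν : ℝ := Real.exp 1 * (M (N + 1) / M N) with hν
  have hν0 : 0 < ν := mul_pos (Real.exp_pos _) (div_pos (hpos _) (hpos _))
  have growth : ∀ j n : ℕ, n + j = N + 1 → ∀ s ∈ Set.Icc x y,
      ‖F n s‖ ≤ Real.exp (n - (N + 1)) * M n * Real.exp (ν * (s - x)) := by
    intro j
    induction j with
    | zero =>
      intro n hn s hs
      obtain rfl : n = N + 1 := by omega
      have h1 : 1 ≤ Real.exp (ν * (s - x)) :=
        Real.one_le_exp (mul_nonneg hν0.le (sub_nonneg.2 hs.1))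
      have h2 := hbd (N + 1) s ⟨hx0.trans hs.1, hs.2.trans hyb⟩
      push_cast
      rw [sub_self, Real.exp_zero, one_mul]
      exact h2.trans (le_mul_of_one_le_right (hpos _).le h1)
    | succ j ih =>
      intro n hn
      have hsub : Set.Icc x y ⊆ Set.Icc 0 b := Set.Icc_subset_Icc hx0 hyb
      refine image_norm_le_of_norm_deriv_right_le_deriv_boundary
        (f := F n) (f' := F (n + 1))
        (B' := fun s => Real.exp (n - (N + 1)) * M n * (Real.exp (ν * (s - x)) * ν))
        (fun s hs => ((hF n s (hsub hs)).continuousWithinAt).mono hsub) ?_ ?_ ?_ ?_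
      · intro s hs
        have hs' : s ∈ Set.Icc x y := Set.Ico_subset_Icc_self hs
        exact (hF n s (hsub hs')).mono_of_mem_nhdsWithin
          (mem_of_superset (Icc_mem_nhdsGE (hs.2.trans_le hyb))
            (Set.Icc_subset_Icc_left (hx0.trans hs.1)))
      · simpa using hx n (by omega)
      · intro s
        have h := ((hasDerivAt_id s).sub_const x).const_mul ν
        simpa using h.exp.const_mul (Real.exp (n - (N + 1)) * M n)
      · intro s hs
        refine (ih (n + 1) (by omega) s (Set.Ico_subset_Icc_self hs)).trans ?_
        have h1 : M (n + 1) ≤ M n * (M (N + 1) / M N) := by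
          have := hmono (show n ≤ N by omega)
          simp only at this
          rwa [div_le_iff₀' (hpos n)] at this
        have h2 : Real.exp ((n + 1 : ℕ) - (N + 1)) = Real.exp (n - (N + 1)) * Real.exp 1 := by
          rw [← Real.exp_add]; push_cast; ring_nf
        rw [h2, hν]
        calc Real.exp (n - (N + 1)) * Real.exp 1 * M (n + 1) * Real.exp (ν * (s - x))
            ≤ Real.exp (n - (N + 1)) * Real.exp 1 * (M n * (M (N + 1) / M N))
                * Real.exp (ν * (s - x)) := by gcongr
          _ = _ := by ring
  intro n hn
  have h1 := growth (N + 1 - n) n (by omega) y ⟨hxy, le_rfl⟩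
  have h2 : ν * (y - x) ≤ 1 := by
    calc ν * (y - x) ≤ ν * (M N / M (N + 1) / Real.exp 1) := by gcongr
      _ = 1 := by
        have := (hpos N).ne'
        have := (hpos (N + 1)).ne'
        rw [hν]; field_simp
  calc ‖F n y‖ ≤ Real.exp (n - (N + 1)) * M n * Real.exp (ν * (y - x)) := h1
    _ ≤ Real.exp (n - (N + 1)) * M n * Real.exp 1 := by
        have := hpos n
        gcongr
    _ = Real.exp (n - N) * M n := by
        rw [mul_right_comm, ← Real.exp_add]; ring_nf

/-- One-dimensional quasianalyticity, for a function `F 0` with successive derivatives `F k`. -/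
theorem eq_zero_of_flat_of_not_summable (hpos : ∀ k, 0 < M k)
    (hmono : Monotone fun k => M (k + 1) / M k)
    (hsum : ¬ Summable fun k => M k / M (k + 1)) (hb : 0 ≤ b)
    (hF : ∀ k, ∀ t ∈ Set.Icc 0 b, HasDerivWithinAt (F k) (F (k + 1) t) (Set.Icc 0 b) t)
    (hbd : ∀ k, ∀ t ∈ Set.Icc 0 b, ‖F k t‖ ≤ M k) (hflat : ∀ k, F k 0 = 0) : F 0 b = 0 := by
  have reach : ∀ d N : ℕ, ∀ y ∈ Set.Icc 0 b,
      y ≤ ∑ j ∈ Finset.range d, M (j + N) / M (j + N + 1) / Real.exp 1 →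
      ∀ n < N, ‖F n y‖ ≤ Real.exp (n - N) * M n := by
    intro d
    induction d with
    | zero =>
      intro N y hy hyd n _
      have : y = 0 := le_antisymm (by simpa using hyd) hy.1
      rw [this, hflat, norm_zero]
      exact mul_nonneg (Real.exp_pos _).le (hpos n).le
    | succ d ih =>
      intro N y hy hyd
      rw [Finset.sum_range_succ'] at hyd
      have hstep : 0 ≤ M N / M (N + 1) / Real.exp 1 :=
        div_nonneg (div_nonneg (hpos _).le (hpos _).le) (Real.exp_pos _).le
      set s := M N / M (N + 1) / Real.exp 1
      have hx : max 0 (y - s) ∈ Set.Icc 0 b :=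
        ⟨le_max_left _ _, max_le hb (by linarith [hy.2])⟩
      refine bang_propagation hpos hmono hF hbd hx.1 (max_le hy.1 (by linarith)) hy.2
        (show y - max 0 (y - s) ≤ s by linarith [le_max_right 0 (y - s)]) ?_
      have := ih (N + 1) (max 0 (y - s)) hx (max_le (Finset.sum_nonneg fun j _ =>
        div_nonneg (div_nonneg (hpos _).le (hpos _).le) (Real.exp_pos _).le) ?_)
      · exact_mod_cast this
      · have e : ∀ j, j + (N + 1) = j + 1 + N := fun j => by ring
        simp only [e]
        simp only [zero_add] at hyd
        change y ≤ _ + s at hyd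
        linarith
  have small : ∀ N : ℕ, ‖F 0 b‖ ≤ Real.exp (-((N + 1 : ℕ) : ℝ)) * M 0 := by
    intro N
    have h1 : ¬ Summable fun j => M (j + (N + 1)) / M (j + (N + 1) + 1) / Real.exp 1 := by
      intro h
      refine hsum ((summable_nat_add_iff (N + 1)).1 ?_)
      simpa using h.mul_right (Real.exp 1)
    rw [not_summable_iff_tendsto_nat_atTop_of_nonneg (fun j =>
      div_nonneg (div_nonneg (hpos _).le (hpos _).le) (Real.exp_pos _).le)] at h1
    obtain ⟨d, hd⟩ := (h1.eventually_ge_atTop b).exists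
    simpa using reach d (N + 1) b ⟨hb, le_rfl⟩ hd 0 (Nat.succ_pos N)
  have hlim : Tendsto (fun N : ℕ => Real.exp (-((N + 1 : ℕ) : ℝ)) * M 0) atTop (𝓝 0) := by
    have h := (Real.tendsto_exp_neg_atTop_nhds_zero.comp
      (tendsto_natCast_atTop_atTop.comp (tendsto_add_atTop_nat 1))).mul_const (M 0)
    simpa [Function.comp_def] using h
  exact norm_le_zero_iff.1 (ge_of_tendsto' hlim small)

end Bang

namespace IsWeightSeq

variable {M : ℕ → ℝ}

theorem ratio_le_succ (hM : IsWeightSeq M) (k : ℕ) :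
    M (k + 1) / M k ≤ M (k + 2) / M (k + 1) := by
  have h := hM.logConvex (k + 1) (by omega)
  rw [div_le_div_iff₀ (hM.pos _) (hM.pos _)]
  simp only [Nat.add_sub_cancel] at h
  nlinarith [h]

/-- A function `f ∈ E_M(Ω)` that is flat at `p` vanishes near `p`, if `∑ M k / M (k + 1) = ∞`. -/
theorem eventually_eq_zero_of_flat (hM : IsWeightSeq M)
    (hsum : ¬ Summable fun k => M k / M (k + 1)) {n : ℕ} {Ω : Set (Fin n → ℝ)}
    (hΩ : IsOpen Ω) {f : (Fin n → ℝ) → ℂ} (hf : MemDC M Ω f) {p : Fin n → ℝ} (hp : p ∈ Ω)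
    (hflat : ∀ k : ℕ, iteratedFDerivWithin ℝ k f Ω p = 0) : ∀ᶠ x in 𝓝 p, f x = 0 := by
  obtain ⟨r, hr, hrΩ⟩ := Metric.nhds_basis_closedBall.mem_iff.1 (hΩ.mem_nhds hp)
  obtain ⟨C, hC, h, hh, hbd⟩ := hf.2 _ hrΩ (isCompact_closedBall p r)
  filter_upwards [Metric.closedBall_mem_nhds p hr] with x hx
  set v := x - p with hv
  have hvr : ‖v‖ ≤ r := by rwa [Metric.mem_closedBall, dist_eq_norm] at hx
  have hmem : ∀ t ∈ Set.Icc (0 : ℝ) 1, p + t • v ∈ Metric.closedBall p r := by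
    intro t ht
    rw [Metric.mem_closedBall, dist_eq_norm, add_sub_cancel_left, norm_smul, Real.norm_eq_abs,
      abs_of_nonneg ht.1]
    nlinarith [norm_nonneg v, ht.1, ht.2]
  set F : ℕ → ℝ → ℂ := fun k t => iteratedFDeriv ℝ k f (p + t • v) fun _ => v with hFdef
  have key : F 0 1 = 0 := by
    refine eq_zero_of_flat_of_not_summable (M := fun k => C * (h * r) ^ k * M k) (F := F) ?_ ?_ ?_
      zero_le_one ?_ ?_ ?_
    · intro k
      have := hM.pos k
      positivity
    · refine monotone_nat_of_le_succ fun k => ?_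
      have e : ∀ j, C * (h * r) ^ (j + 1) * M (j + 1) / (C * (h * r) ^ j * M j)
          = h * r * (M (j + 1) / M j) := by
        intro j
        have := (hM.pos j).ne'
        field_simp
        ring
      simp only [e]
      have := hM.ratio_le_succ k
      gcongr
    · intro hs
      refine hsum ((hs.mul_left (h * r)).congr fun j => ?_)
      have := (hM.pos (j + 1)).ne'
      field_simp
      ring
    · intro k t ht
      have hq := hrΩ (hmem t ht)
      have hd : DifferentiableAt ℝ (iteratedFDeriv ℝ k f) (p + t • v) :=
        (hf.1.contDiffAt (hΩ.mem_nhds hq)).differentiableAt_iteratedFDeriv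
          (by exact_mod_cast ENat.natCast_lt_top k)
      have hline : HasDerivAt (fun s : ℝ => p + s • v) v t := by
        simpa using ((hasDerivAt_id t).smul_const v).const_add p
      have h1 := hd.hasFDerivAt.comp_hasDerivAt t hline
      exact ((ContinuousMultilinearMap.apply ℝ (fun _ : Fin k => Fin n → ℝ) ℂ
        fun _ => v).hasFDerivAt.comp_hasDerivAt t h1).hasDerivWithinAt
    · intro k t ht
      have h1 := hbd k _ (hmem t ht)
      rw [iteratedFDerivWithin_of_isOpen k hΩ (hrΩ (hmem t ht))] at h1
      calc ‖F k t‖ ≤ ‖iteratedFDeriv ℝ k f (p + t • v)‖ * ∏ _i : Fin k, ‖v‖ :=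
            ContinuousMultilinearMap.le_opNorm _ _
        _ ≤ (C * h ^ k * M k) * r ^ k := by
            rw [Finset.prod_const, Finset.card_univ, Fintype.card_fin]
            gcongr
            exact (norm_nonneg _).trans h1
        _ = C * (h * r) ^ k * M k := by rw [mul_pow]; ring
    · intro k
      have h1 := hflat k
      rw [iteratedFDerivWithin_of_isOpen k hΩ hp] at h1
      simp [hFdef, h1]
  simpa [hFdef, hv] using key

theorem quasianalytic_of_not_summable (hM : IsWeightSeq M)
    (hsum : ¬ Summable fun k => M k / M (k + 1)) {n : ℕ} {Ω : Set (Fin n → ℝ)}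
    (hΩ : IsOpen Ω) : Quasianalytic M Ω := by
  intro f hf p hp hflat x hx
  set Z : Set (Fin n → ℝ) := {y | y ∈ Ω ∧ ∀ k : ℕ, iteratedFDerivWithin ℝ k f Ω y = 0}
  have hZ : IsOpen Z := by
    refine isOpen_iff_mem_nhds.2 fun y hy => ?_
    have h0 : f =ᶠ[𝓝 y] fun _ => 0 := hM.eventually_eq_zero_of_flat hsum hΩ hf hy.1 hy.2
    filter_upwards [hΩ.mem_nhds hy.1, h0.eventuallyEq_nhds] with z hz hz0
    refine ⟨hz, fun k => ?_⟩
    rw [iteratedFDerivWithin_of_isOpen k hΩ hz, (hz0.iteratedFDeriv ℝ k).eq_of_nhds]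
    rw [iteratedFDeriv_fun_zero, Pi.zero_apply]
  have hsub : connectedComponentIn Ω p ⊆ Z := by
    refine isPreconnected_connectedComponentIn.subset_of_closure_inter_subset hZ
      ⟨p, mem_connectedComponentIn hp, hp, hflat⟩ ?_
    rintro y ⟨hyZ, hyc⟩
    have hy : y ∈ Ω := connectedComponentIn_subset Ω p hyc
    refine ⟨hy, fun k => ?_⟩
    have hcont := ((hf.1.continuousOn_iteratedFDerivWithin (m := k)
      (by exact_mod_cast le_top) hΩ.uniqueDiffOn) y hy).mono (fun z (hz : z ∈ Z) => hz.1)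
    have := mem_closure_iff_nhdsWithin_neBot.1 hyZ
    exact tendsto_nhds_unique hcont
      (tendsto_const_nhds.congr' (eventually_nhdsWithin_of_forall fun z hz => (hz.2 k).symm))
  have h0 := (hsub hx).2 0
  have h1 : iteratedFDerivWithin ℝ 0 f Ω x 0 = 0 := by rw [h0]; rfl
  simpa using h1

end IsWeightSeq

section MovingAverage

/-- The average of `f` over the interval `[x - a, x]`. -/
noncomputable def movingAverage (a : ℝ) (f : ℝ → ℝ) (x : ℝ) : ℝ :=
  a⁻¹ * ∫ t in (x - a)..x, f t

variable {a : ℝ} {f : ℝ → ℝ}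

theorem hasDerivAt_movingAverage (hf : Continuous f) (x : ℝ) :
    HasDerivAt (movingAverage a f) (a⁻¹ * (f x - f (x - a))) x := by
  have e : movingAverage a f
      = fun y => a⁻¹ * ((∫ t in (0 : ℝ)..y, f t) - ∫ t in (0 : ℝ)..(y - a), f t) := by
    funext y
    rw [intervalIntegral.integral_interval_sub_left (hf.intervalIntegrable _ _)
      (hf.intervalIntegrable _ _)]
    rfl
  have h1 : ∀ y, HasDerivAt (fun y => ∫ t in (0 : ℝ)..y, f t) (f y) y := fun y =>
    intervalIntegral.integral_hasDerivAt_right (hf.intervalIntegrable _ _)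
      (hf.stronglyMeasurableAtFilter _ _) hf.continuousAt
  rw [e]
  exact ((h1 x).sub ((h1 (x - a)).comp_sub_const x a)).const_mul a⁻¹

theorem deriv_movingAverage (hf : ContDiff ℝ (⊤ : ℕ∞) f) :
    deriv (movingAverage a f) = movingAverage a (deriv f) := by
  funext x
  rw [(hasDerivAt_movingAverage hf.continuous x).deriv, movingAverage,
    intervalIntegral.integral_deriv_eq_sub
      (fun y _ => (hf.differentiable (by simp)).differentiableAt)
      ((hf.continuous_deriv (by simp)).intervalIntegrable _ _)]

theorem contDiff_movingAverage (hf : ContDiff ℝ (⊤ : ℕ∞) f) :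
    ContDiff ℝ (⊤ : ℕ∞) (movingAverage a f) := by
  refine contDiff_infty_iff_deriv.2
    ⟨fun x => (hasDerivAt_movingAverage hf.continuous x).differentiableAt, ?_⟩
  have e : deriv (movingAverage a f) = fun x => a⁻¹ * (f x - f (x - a)) :=
    funext fun x => (hasDerivAt_movingAverage hf.continuous x).deriv
  rw [e]
  exact contDiff_const.mul (hf.sub (hf.comp (contDiff_id.sub contDiff_const)))

theorem contDiff_iteratedDeriv (hf : ContDiff ℝ (⊤ : ℕ∞) f) (k : ℕ) :
    ContDiff ℝ (⊤ : ℕ∞) (iteratedDeriv k f) := by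
  rw [iteratedDeriv_eq_iterate]
  exact hf.iterate_deriv k

theorem iteratedDeriv_movingAverage (hf : ContDiff ℝ (⊤ : ℕ∞) f) (k : ℕ) :
    iteratedDeriv k (movingAverage a f) = movingAverage a (iteratedDeriv k f) := by
  induction k with
  | zero => simp
  | succ k ih =>
    rw [iteratedDeriv_succ, ih, deriv_movingAverage (contDiff_iteratedDeriv hf k),
      iteratedDeriv_succ]

theorem movingAverage_sub_const (ha : 0 < a) (hf : Continuous f) (c x : ℝ) :
    movingAverage a f x - c = movingAverage a (fun t => f t - c) x := by
  rw [movingAverage, movingAverage, intervalIntegral.integral_sub (hf.intervalIntegrable _ _)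
    (continuous_const.intervalIntegrable _ _), intervalIntegral.integral_const]
  simp only [smul_eq_mul, sub_sub_cancel]
  field_simp

theorem abs_movingAverage_sub_le (ha : 0 < a) (hf : Continuous f) {c B x : ℝ}
    (h : ∀ t ∈ Set.Icc (x - a) x, |f t - c| ≤ B) : |movingAverage a f x - c| ≤ B := by
  have h1 : ‖∫ t in (x - a)..x, (f t - c)‖ ≤ B * |x - (x - a)| :=
    intervalIntegral.norm_integral_le_of_norm_le_const fun t ht => by
      rw [Set.uIoc_of_le (by linarith)] at ht
      exact h t ⟨ht.1.le, ht.2⟩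
  rw [sub_sub_cancel, abs_of_pos ha, Real.norm_eq_abs] at h1
  rw [movingAverage_sub_const ha hf, movingAverage, abs_mul, abs_of_pos (inv_pos.2 ha),
    inv_mul_le_iff₀ ha, mul_comm a B]
  exact h1

theorem abs_movingAverage_le (ha : 0 < a) (hf : Continuous f) {B : ℝ} (h : ∀ t, |f t| ≤ B)
    (x : ℝ) : |movingAverage a f x| ≤ B := by
  simpa using abs_movingAverage_sub_le ha hf (c := 0) (x := x) fun t _ => by simpa using h t

theorem abs_movingAverage_sub_self_le (ha : 0 < a) (hf : ContDiff ℝ (⊤ : ℕ∞) f) {B : ℝ}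
    (h : ∀ t, |deriv f t| ≤ B) (x : ℝ) : |movingAverage a f x - f x| ≤ a * B := by
  refine abs_movingAverage_sub_le ha hf.continuous fun t ht => ?_
  have hB : 0 ≤ B := (abs_nonneg _).trans (h 0)
  have h1 := convex_univ.norm_image_sub_le_of_norm_deriv_le (𝕜 := ℝ) (f := f) (C := B)
    (fun y _ => (hf.differentiable (by simp)).differentiableAt) (fun y _ => h y)
    (Set.mem_univ x) (Set.mem_univ t)
  have h2 : |t - x| ≤ a := abs_le.2 ⟨by linarith [ht.1], by linarith [ht.2]⟩
  calc |f t - f x| ≤ B * |t - x| := h1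
    _ ≤ B * a := by gcongr
    _ = a * B := mul_comm _ _

theorem abs_iteratedDeriv_succ_movingAverage_le (ha : 0 < a) (hf : ContDiff ℝ (⊤ : ℕ∞) f)
    {k : ℕ} {B : ℝ} (h : ∀ t, |iteratedDeriv k f t| ≤ B) (x : ℝ) :
    |iteratedDeriv (k + 1) (movingAverage a f) x| ≤ 2 / a * B := by
  rw [iteratedDeriv_succ, iteratedDeriv_movingAverage hf,
    (hasDerivAt_movingAverage (contDiff_iteratedDeriv hf k).continuous x).deriv, abs_mul,
    abs_of_pos (inv_pos.2 ha)]
  have h1 := abs_sub (iteratedDeriv k f x) (iteratedDeriv k f (x - a))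
  have h2 := h x
  have h3 := h (x - a)
  calc a⁻¹ * |iteratedDeriv k f x - iteratedDeriv k f (x - a)| ≤ a⁻¹ * (B + B) := by
        gcongr; linarith
    _ = 2 / a * B := by ring

end MovingAverage

section Construction

theorem exists_abs_iteratedDeriv_smoothTransition_le (k : ℕ) :
    ∃ B, ∀ x, |iteratedDeriv k Real.smoothTransition x| ≤ B := by
  have hs : ContDiff ℝ (⊤ : ℕ∞) Real.smoothTransition := Real.smoothTransition.contDiff
  obtain ⟨B, hB⟩ := isCompact_Icc.exists_bound_of_continuousOn (s := Set.Icc (0 : ℝ) 1)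
    (contDiff_iteratedDeriv hs k).continuous.continuousOn
  have hconst : ∀ c x : ℝ, |c| ≤ 1 → Real.smoothTransition =ᶠ[𝓝 x] (fun _ => c) →
      |iteratedDeriv k Real.smoothTransition x| ≤ 1 := by
    intro c x hc h
    rw [h.iteratedDeriv_eq k, iteratedDeriv_const]
    split_ifs
    · exact hc
    · simp
  refine ⟨max B 1, fun x => ?_⟩
  rcases lt_or_ge x 0 with h0 | h0
  · refine le_max_of_le_right (hconst 0 x (by simp) ?_)
    filter_upwards [Iio_mem_nhds h0] with y hy
    exact Real.smoothTransition.zero_of_nonpos (le_of_lt hy)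
  rcases lt_or_ge 1 x with h1 | h1
  · refine le_max_of_le_right (hconst 1 x (by simp) ?_)
    filter_upwards [Ioi_mem_nhds h1] with y hy
    exact Real.smoothTransition.one_of_one_le (le_of_lt hy)
  · exact le_max_of_le_left (hB x ⟨h0, h1⟩)

/-- Successive moving averages, of widths `a 0, a 1, …`, of a smooth step. -/
noncomputable def smoothedStep (a : ℕ → ℝ) : ℕ → ℝ → ℝ
  | 0 => Real.smoothTransition
  | N + 1 => movingAverage (a N) (smoothedStep a N)

variable {a : ℕ → ℝ}

theorem contDiff_smoothedStep (a : ℕ → ℝ) (N : ℕ) :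
    ContDiff ℝ (⊤ : ℕ∞) (smoothedStep a N) := by
  induction N with
  | zero => exact Real.smoothTransition.contDiff
  | succ N ih => exact contDiff_movingAverage ih

theorem smoothedStep_of_nonpos (ha : ∀ j, 0 < a j) (N : ℕ) {x : ℝ} (hx : x ≤ 0) :
    smoothedStep a N x = 0 := by
  induction N generalizing x with
  | zero => exact Real.smoothTransition.zero_of_nonpos hx
  | succ N ih =>
    have := abs_movingAverage_sub_le (ha N) (contDiff_smoothedStep a N).continuous (c := 0)
      (B := 0) (x := x) fun t ht => by simp [ih (ht.2.trans hx)]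
    simpa [smoothedStep] using this

theorem smoothedStep_of_ge (ha : ∀ j, 0 < a j) (N : ℕ) {x : ℝ}
    (hx : 1 + ∑ j ∈ Finset.range N, a j ≤ x) : smoothedStep a N x = 1 := by
  induction N generalizing x with
  | zero => exact Real.smoothTransition.one_of_one_le (by simpa using hx)
  | succ N ih =>
    rw [Finset.sum_range_succ] at hx
    have := abs_movingAverage_sub_le (ha N) (contDiff_smoothedStep a N).continuous (c := 1)
      (B := 0) (x := x) fun t ht => by simp [ih (show _ ≤ t by linarith [ht.1])]
    simpa [smoothedStep, sub_eq_zero] using this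

theorem abs_iteratedDeriv_smoothedStep_le_of_le (ha : ∀ j, 0 < a j) {k N₀ N : ℕ} (hN : N₀ ≤ N)
    {B : ℝ} (h : ∀ x, |iteratedDeriv k (smoothedStep a N₀) x| ≤ B) (x : ℝ) :
    |iteratedDeriv k (smoothedStep a N) x| ≤ B := by
  induction N, hN using Nat.le_induction generalizing x with
  | base => exact h x
  | succ N _ ih =>
    rw [smoothedStep, iteratedDeriv_movingAverage (contDiff_smoothedStep a N)]
    exact abs_movingAverage_le (ha N)
      (contDiff_iteratedDeriv (contDiff_smoothedStep a N) k).continuous ih x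

theorem abs_iteratedDeriv_smoothedStep_le_prod (ha : ∀ j, 0 < a j) {k N : ℕ} (hN : k ≤ N)
    (x : ℝ) : |iteratedDeriv k (smoothedStep a N) x| ≤ ∏ j ∈ Finset.range k, 2 / a j := by
  refine abs_iteratedDeriv_smoothedStep_le_of_le ha hN (fun y => ?_) x
  clear hN
  induction k generalizing y with
  | zero =>
    simpa [smoothedStep, abs_of_nonneg (Real.smoothTransition.nonneg y)] using
      Real.smoothTransition.le_one y
  | succ k ih =>
    rw [Finset.prod_range_succ, mul_comm]
    exact abs_iteratedDeriv_succ_movingAverage_le (ha k) (contDiff_smoothedStep a k) ih y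

/-- If `∑ a j < ∞`, there is a smooth step on `ℝ` whose `k`-th derivative is bounded by
`2 ^ k / (a 0 * ⋯ * a (k - 1))`. -/
theorem exists_smooth_step_of_summable (ha : ∀ j, 0 < a j) (hsum : Summable a) :
    ∃ φ : ℝ → ℝ, ∃ R : ℝ, ContDiff ℝ (⊤ : ℕ∞) φ ∧ (∀ x ≤ 0, φ x = 0) ∧ (∀ x ≥ R, φ x = 1) ∧
      ∀ (k : ℕ) (x : ℝ), ‖iteratedFDeriv ℝ k φ x‖ ≤ ∏ j ∈ Finset.range k, 2 / a j := by
  choose B hB using exists_abs_iteratedDeriv_smoothTransition_le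
  set u : ℕ → ℝ → ℝ := fun i =>
    Nat.casesOn i (smoothedStep a 0) fun i => smoothedStep a (i + 1) - smoothedStep a i with hu
  set w : ℕ → ℕ → ℝ := fun k i => Nat.casesOn i (B k) fun i => a i * B (k + 1) with hw
  have hsmooth := contDiff_smoothedStep a
  have husmooth : ∀ i, ContDiff ℝ (⊤ : ℕ∞) (u i) := by
    rintro (_ | i)
    · exact hsmooth 0
    · exact (hsmooth (i + 1)).sub (hsmooth i)
  have hwsum : ∀ k : ℕ, (k : ℕ∞) ≤ ⊤ → Summable (w k) := fun k _ =>
    (summable_nat_add_iff 1).1 (hsum.mul_right (B (k + 1)))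
  have hbound : ∀ (k i : ℕ) (x : ℝ), (k : ℕ∞) ≤ ⊤ → ‖iteratedFDeriv ℝ k (u i) x‖ ≤ w k i := by
    intro k i x _
    rw [norm_iteratedFDeriv_eq_norm_iteratedDeriv]
    rcases i with _ | i
    · exact hB k x
    · have hk : ∀ N, ContDiffAt ℝ k (smoothedStep a N) x := fun N =>
        (hsmooth N).contDiffAt.of_le (by exact_mod_cast le_top)
      change ‖iteratedDeriv k (smoothedStep a (i + 1) - smoothedStep a i) x‖ ≤ a i * B (k + 1)
      rw [iteratedDeriv_sub (hk _) (hk _), smoothedStep, iteratedDeriv_movingAverage (hsmooth i)]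
      refine abs_movingAverage_sub_self_le (ha i) (contDiff_iteratedDeriv (hsmooth i) k) ?_ x
      rw [← iteratedDeriv_succ]
      exact abs_iteratedDeriv_smoothedStep_le_of_le ha (Nat.zero_le i) (hB (k + 1))
  have hpartial : ∀ (k N : ℕ) (x : ℝ), ∑ i ∈ Finset.range (N + 1), iteratedFDeriv ℝ k (u i) x
      = iteratedFDeriv ℝ k (smoothedStep a N) x := by
    intro k N x
    induction N with
    | zero => simp [hu]
    | succ N ih =>
      rw [Finset.sum_range_succ, ih]
      change _ + iteratedFDeriv ℝ k (smoothedStep a (N + 1) - smoothedStep a N) x = _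
      have hk : ∀ N, ContDiffAt ℝ k (smoothedStep a N) x := fun N =>
        (hsmooth N).contDiffAt.of_le (by exact_mod_cast le_top)
      rw [iteratedFDeriv_sub_apply (hk _) (hk _), add_sub_cancel]
  set φ : ℝ → ℝ := fun x => ∑' i, u i x with hφ
  have hlim : ∀ (k : ℕ) (x : ℝ), Tendsto (fun N => iteratedFDeriv ℝ k (smoothedStep a N) x) atTop
      (𝓝 (iteratedFDeriv ℝ k φ x)) := by
    intro k x
    have h1 : Summable fun i => iteratedFDeriv ℝ k (u i) x :=
      Summable.of_norm_bounded (hwsum k le_top) fun i => hbound k i x le_top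
    have h2 := (tendsto_add_atTop_iff_nat 1).2 h1.hasSum.tendsto_sum_nat
    simp only [hpartial] at h2
    rwa [hφ, iteratedFDeriv_tsum husmooth hwsum hbound le_top]
  have hlim0 : ∀ x, Tendsto (fun N => smoothedStep a N x) atTop (𝓝 (φ x)) := by
    intro x
    have := ((ContinuousMultilinearMap.apply ℝ (fun _ : Fin 0 => ℝ) ℝ 0).continuous.tendsto
      _).comp (hlim 0 x)
    simpa [Function.comp_def] using this
  refine ⟨φ, 1 + ∑' j, a j, contDiff_tsum husmooth hwsum hbound, fun x hx => ?_, fun x hx => ?_,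
    fun k x => ?_⟩
  · refine tendsto_nhds_unique (hlim0 x) (tendsto_const_nhds.congr fun N => ?_)
    exact (smoothedStep_of_nonpos ha N hx).symm
  · refine tendsto_nhds_unique (hlim0 x) (tendsto_const_nhds.congr fun N => ?_)
    have := hsum.sum_le_tsum (Finset.range N) fun j _ => (ha j).le
    exact (smoothedStep_of_ge ha N (by linarith)).symm
  · refine le_of_tendsto (hlim k x).norm ?_
    filter_upwards [eventually_ge_atTop k] with N hN
    rw [norm_iteratedFDeriv_eq_norm_iteratedDeriv]
    exact abs_iteratedDeriv_smoothedStep_le_prod ha hN x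

end Construction

namespace IsWeightSeq

variable {M : ℕ → ℝ}

theorem prod_two_div_ratio (hM : IsWeightSeq M) (k : ℕ) :
    ∏ j ∈ Finset.range k, 2 / (M j / M (j + 1)) = 2 ^ k * M k := by
  induction k with
  | zero => simp [hM.one]
  | succ k ih =>
    have := (hM.pos k).ne'
    have := (hM.pos (k + 1)).ne'
    rw [Finset.prod_range_succ, ih]
    field_simp
    ring

theorem not_quasianalytic_of_summable (hM : IsWeightSeq M)
    (hsum : Summable fun k => M k / M (k + 1)) {n : ℕ} (hn : 0 < n) {Ω : Set (Fin n → ℝ)}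
    (hΩ : IsOpen Ω) (hne : Ω.Nonempty) : ¬ Quasianalytic M Ω := by
  obtain ⟨φ, R, hφ, hφ0, hφ1, hφbd⟩ :=
    exists_smooth_step_of_summable (fun j => div_pos (hM.pos j) (hM.pos (j + 1))) hsum
  simp only [hM.prod_two_div_ratio] at hφbd
  obtain ⟨p, hp⟩ := hne
  obtain ⟨r, hr, hrΩ⟩ := Metric.isOpen_iff.1 hΩ p hp
  let i₀ : Fin n := ⟨0, hn⟩
  set c : ℝ := 2 * (|R| + 1) / r with hc
  have hc0 : 0 < c := by positivity
  set L : (Fin n → ℝ) →L[ℝ] ℝ := c • ContinuousLinearMap.proj i₀ with hL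
  set s : ℝ := c * p i₀ + 1 with hs
  set ψ : ℝ → ℂ := fun t => φ (t - s) with hψ
  have hφs : ContDiff ℝ (⊤ : ℕ∞) fun t => φ (t - s) := hφ.comp (contDiff_id.sub contDiff_const)
  have hψsmooth : ContDiff ℝ (⊤ : ℕ∞) ψ := Complex.ofRealCLM.contDiff.comp hφs
  have hψbd : ∀ (k : ℕ) t, ‖iteratedFDeriv ℝ k ψ t‖ ≤ 2 ^ k * M k := by
    intro k t
    have h1 := Complex.ofRealLI.norm_iteratedFDeriv_comp_left (hφs.contDiffAt (x := t))
      (i := k) (by exact_mod_cast le_top)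
    rw [iteratedFDeriv_comp_sub] at h1
    exact h1.le.trans (hφbd k _)
  have hmem : MemDC M Ω (ψ ∘ L) := by
    refine ⟨(hψsmooth.comp L.contDiff).contDiffOn, fun K hK _ => ?_⟩
    refine ⟨1, one_pos, 2 * (‖L‖ + 1), by positivity, fun k x hx => ?_⟩
    rw [iteratedFDerivWithin_of_isOpen k hΩ (hK hx),
      L.iteratedFDeriv_comp_right hψsmooth x (by exact_mod_cast le_top)]
    refine (ContinuousMultilinearMap.norm_compContinuousLinearMap_le _ _).trans ?_
    rw [Finset.prod_const, Finset.card_univ, Fintype.card_fin]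
    have := (hM.pos k).le
    calc ‖iteratedFDeriv ℝ k ψ (L x)‖ * ‖L‖ ^ k ≤ 2 ^ k * M k * (‖L‖ + 1) ^ k := by
          gcongr
          · exact hψbd k _
          · linarith
      _ = 1 * (2 * (‖L‖ + 1)) ^ k * M k := by rw [mul_pow]; ring
  have hflat : ∀ k : ℕ, iteratedFDerivWithin ℝ k (ψ ∘ L) Ω p = 0 := by
    intro k
    have h0 : ψ ∘ L =ᶠ[𝓝 p] fun _ => 0 := by
      have : ∀ᶠ x in 𝓝 p, L x < s :=
        L.continuous.continuousAt.eventually_lt continuousAt_const (by simp [hL, hs])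
      filter_upwards [this] with x hx
      simp [hψ, hφ0 (L x - s) (by linarith)]
    rw [iteratedFDerivWithin_of_isOpen k hΩ hp, (h0.iteratedFDeriv ℝ k).eq_of_nhds,
      iteratedFDeriv_fun_zero, Pi.zero_apply]
  intro hquasi
  set q : Fin n → ℝ := fun j => p j + r / 2 with hq
  have hqball : q ∈ Metric.ball p r := by
    rw [Metric.mem_ball, dist_pi_lt_iff hr]
    intro j
    rw [hq, Real.dist_eq, add_sub_cancel_left, abs_of_pos (by positivity)]
    linarith
  have hqcomp : q ∈ connectedComponentIn Ω p :=
    (convex_ball p r).isPreconnected.subset_connectedComponentIn (Metric.mem_ball_self hr) hrΩ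
      hqball
  have h1 := hquasi _ hmem p hp hflat q hqcomp
  have h2 : L q - s = |R| := by
    have : L q = c * (p i₀ + r / 2) := by simp [hL, hq]
    rw [this, hs, hc]
    field_simp
    ring
  simp [hψ, h2, hφ1 |R| (le_abs_self R)] at h1

end IsWeightSeq

/-- The Denjoy–Carleman theorem: `E_M(Ω)` is quasianalytic iff `Σ M_{k-1}/M_k = ∞`. -/
theorem stmt_9 (M : ℕ → ℝ) (hM : IsWeightSeq M)
    {n : ℕ} (hn : 0 < n) (Ω : Set (Fin n → ℝ)) (hΩ : IsOpen Ω) (hne : Ω.Nonempty) :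
    Quasianalytic M Ω ↔ ¬ Summable (fun k : ℕ => M k / M (k + 1)) := by
  refine ⟨fun h hsum => hM.not_quasianalytic_of_summable hsum hn hΩ hne h, fun hsum =>
    hM.quasianalytic_of_not_summable hsum hΩ⟩
end
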